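/- Fix an integer n ≥ 1 and let W_n be the R-submodule of C_n ⊗_R C_n spanned by: y_i⊗y_i for odd i with −2n+1 ≤ i ≤ 2n−1; y_i⊗y_{i+2} for odd i with −2n+1 ≤ i ≤ −3 and for odd i with 1 ≤ i ≤ 2n−3; y₁⊗y₋₁; y_i⊗x_{i+1} for odd i with −2n+1 ≤ i ≤ −3 and for odd i with 1 ≤ i ≤ 2n−3; x_i⊗y_{i+1} for even i with −2n+2 ≤ i ≤ −2 and for even i with 2 ≤ i ≤ 2n−2; x₀⊗y₋₁; and y₁⊗x₀. Then: (i) W_n is a subcomplex of C_n⊗_R C_n; (ii) the map Ψ⊗Φ vanishes identically on W_n; (iii) the exchange map τ_exch preserves W_n; and (iv) there is a bigraded isomorphism of chain complexes from the staircase complex D_n onto W_n carrying the reflection involution of D_n to the restriction to W_n of (id + Ψ⊗Φ)∘τ_exch (equivalently, of τ_exch). -/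

import Mathlib

open Finsupp

/-- The field with two elements. -/
abbrev F2 : Type := ZMod 2

/-- The ring `R = F₂[U,V]`: `U = X 0`, `V = X 1`. -/
abbrev R2 : Type := MvPolynomial (Fin 2) F2

noncomputable def UU : R2 := MvPolynomial.X 0
noncomputable def VV : R2 := MvPolynomial.X 1

/-- The involution of `R = F₂[U,V]` exchanging `U` and `V`. -/
noncomputable def swUV : R2 →+* R2 :=
  (MvPolynomial.rename (Equiv.swap (0 : Fin 2) 1)).toRingHom

/-- The skew-equivariant (semilinear over `swUV`) extension of a map given on basis
elements. -/
noncomputable def skewExt {β γ : Type} (f : β → (γ →₀ R2)) :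
    (β →₀ R2) → (γ →₀ R2) :=
  fun ξ => Finsupp.linearCombination R2 f (ξ.mapRange (swUV ·) (map_zero _))

/-- The element `f ⊗ g` in the concrete realization `β × γ →₀ R` of the tensor product
of free `R`-modules. -/
noncomputable def tp {β γ : Type} (f : β →₀ R2) (g : γ →₀ R2) : (β × γ) →₀ R2 :=
  f.sum fun a c => g.sum fun b c' => Finsupp.single (a, b) (c * c')

/-- Homogeneity of bidegree `deg` in a free bigraded `R`-module. -/
def Homog {β : Type} (g : β → ℤ × ℤ) (deg : ℤ × ℤ) (ξ : β →₀ R2) : Prop :=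
  ∀ b ∈ ξ.support, ∀ m ∈ (ξ b).support,
    (g b).1 - 2 * (m 0 : ℤ) = deg.1 ∧ (g b).2 - 2 * (m 1 : ℤ) = deg.2

/-! ### The staircase complex `C_n`, its involution `τ`, and the maps `Φ`, `Ψ` -/

abbrev XIdx (n : ℤ) := {k : ℤ // k % 2 = 0 ∧ -(2*n - 2) ≤ k ∧ k ≤ 2*n - 2}
abbrev YIdx (n : ℤ) := {l : ℤ // l % 2 = 1 ∧ -(2*n - 1) ≤ l ∧ l ≤ 2*n - 1}
abbrev CB (n : ℤ) := XIdx n ⊕ YIdx n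
abbrev Cc (n : ℤ) := CB n →₀ R2

noncomputable def xC (n k : ℤ) : Cc n :=
  if h : k % 2 = 0 ∧ -(2*n - 2) ≤ k ∧ k ≤ 2*n - 2 then single (.inl ⟨k, h⟩) 1 else 0
noncomputable def yC (n l : ℤ) : Cc n :=
  if h : l % 2 = 1 ∧ -(2*n - 1) ≤ l ∧ l ≤ 2*n - 1 then single (.inr ⟨l, h⟩) 1 else 0

/-- The differential of `C_n`: `∂x_k = V^{(k+2n)/2} y_{k−1} + U^{(2n−k)/2} y_{k+1}`. -/
noncomputable def dC (n : ℤ) : Cc n →ₗ[R2] Cc n :=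
  linearCombination R2 fun b => match b with
  | .inl ⟨k, _⟩ =>
      VV ^ (((k + 2*n)/2).toNat) • yC n (k - 1) + UU ^ (((2*n - k)/2).toNat) • yC n (k + 1)
  | .inr _ => 0

/-- Values of the reflection involution `τ` of `C_n` on basis elements. -/
noncomputable def τCb (n : ℤ) : CB n → Cc n := fun b => match b with
  | .inl ⟨k, _⟩ => xC n (-k)
  | .inr ⟨l, _⟩ => yC n (-l)

/-- The map `Φ` of `C_n`, the formal derivative of the differential with respect to `U`:
`Φ(x_k) = ((2n−k)/2)·U^{(2n−k)/2 − 1} y_{k+1}` (coefficient reduced mod 2),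
`Φ(y_ℓ) = 0`. -/
noncomputable def ΦC (n : ℤ) : Cc n →ₗ[R2] Cc n :=
  linearCombination R2 fun b => match b with
  | .inl ⟨k, _⟩ =>
      (MvPolynomial.C ((((2*n - k)/2 : ℤ) : F2)) * UU ^ (((2*n - k)/2 - 1).toNat)) •
        yC n (k + 1)
  | .inr _ => 0

/-- The map `Ψ` of `C_n`, the formal derivative of the differential with respect to `V`:
`Ψ(x_k) = ((k+2n)/2)·V^{(k+2n)/2 − 1} y_{k−1}` (coefficient reduced mod 2),
`Ψ(y_ℓ) = 0`. -/
noncomputable def ΨC (n : ℤ) : Cc n →ₗ[R2] Cc n :=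
  linearCombination R2 fun b => match b with
  | .inl ⟨k, _⟩ =>
      (MvPolynomial.C ((((k + 2*n)/2 : ℤ) : F2)) * VV ^ (((k + 2*n)/2 - 1).toNat)) •
        yC n (k - 1)
  | .inr _ => 0

/-! ### The tensor product `C_n ⊗_R C_n` -/

abbrev Tc (n : ℤ) := (CB n × CB n) →₀ R2

/-- The differential `∂ ⊗ id + id ⊗ ∂` of `C_n ⊗_R C_n`. -/
noncomputable def dT (n : ℤ) : Tc n →ₗ[R2] Tc n :=
  linearCombination R2 fun p =>
    tp (dC n (single p.1 1)) (single p.2 1) + tp (single p.1 1) (dC n (single p.2 1))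

/-- The map `Ψ ⊗ Φ` on `C_n ⊗_R C_n`. -/
noncomputable def ΨΦT (n : ℤ) : Tc n →ₗ[R2] Tc n :=
  linearCombination R2 fun p => tp (ΨC n (single p.1 1)) (ΦC n (single p.2 1))

/-- The exchange map `τ_exch` on `C_n ⊗_R C_n`: the skew-equivariant map determined by
`τ_exch(a ⊗ b) = τ(b) ⊗ τ(a)` on basis elements. -/
noncomputable def τexch (n : ℤ) : Tc n → Tc n :=
  skewExt fun p => tp (τCb n p.2) (τCb n p.1)

/-! ### The staircase complex `D_n` -/

abbrev WIdx (n : ℤ) := {k : ℤ // k % 2 = 1 ∧ -(4*n - 3) ≤ k ∧ k ≤ 4*n - 3}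
abbrev ZIdx (n : ℤ) := {l : ℤ // l % 2 = 0 ∧ -(4*n - 2) ≤ l ∧ l ≤ 4*n - 2}
abbrev DBs (n : ℤ) := WIdx n ⊕ ZIdx n
abbrev Dc (n : ℤ) := DBs n →₀ R2

noncomputable def wD (n k : ℤ) : Dc n :=
  if h : k % 2 = 1 ∧ -(4*n - 3) ≤ k ∧ k ≤ 4*n - 3 then single (.inl ⟨k, h⟩) 1 else 0
noncomputable def zD (n l : ℤ) : Dc n :=
  if h : l % 2 = 0 ∧ -(4*n - 2) ≤ l ∧ l ≤ 4*n - 2 then single (.inr ⟨l, h⟩) 1 else 0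

/-- The differential of `D_n`:
`∂w_k = V^{⌈(k+4n−1)/4⌉} z_{k−1} + U^{⌈(4n−1−k)/4⌉} z_{k+1}` (`⌈m/4⌉ = ⌊(m+3)/4⌋`). -/
noncomputable def dD (n : ℤ) : Dc n →ₗ[R2] Dc n :=
  linearCombination R2 fun b => match b with
  | .inl ⟨k, _⟩ =>
      VV ^ (((k + 4*n + 2)/4).toNat) • zD n (k - 1) +
        UU ^ (((4*n + 2 - k)/4).toNat) • zD n (k + 1)
  | .inr _ => 0

/-- The reflection involution of `D_n`: `w_k ↦ w_{−k}`, `z_ℓ ↦ z_{−ℓ}`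
(skew-equivariant). -/
noncomputable def τD (n : ℤ) : Dc n → Dc n :=
  skewExt fun b => match b with
  | .inl ⟨k, _⟩ => wD n (-k)
  | .inr ⟨l, _⟩ => zD n (-l)

/-! ### Bigradings -/

def IsCGrading (n : ℤ) (gx gy : ℤ → ℤ × ℤ) : Prop :=
  (gy (-(2*n) + 1)).2 = 0 ∧ (gy (2*n - 1)).1 = 0 ∧
  ∀ k : ℤ, k % 2 = 0 → -(2*n - 2) ≤ k → k ≤ 2*n - 2 →
    gy (k - 1) = ((gx k).1 - 1, (gx k).2 - 1 + (k + 2*n)) ∧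
    gy (k + 1) = ((gx k).1 - 1 + (2*n - k), (gx k).2 - 1)

def IsDGrading (n : ℤ) (gw gz : ℤ → ℤ × ℤ) : Prop :=
  (gz (-(4*n) + 2)).2 = 0 ∧ (gz (4*n - 2)).1 = 0 ∧
  ∀ k : ℤ, k % 2 = 1 → -(4*n - 3) ≤ k → k ≤ 4*n - 3 →
    gz (k - 1) = ((gw k).1 - 1, (gw k).2 - 1 + 2*((k + 4*n + 2)/4)) ∧
    gz (k + 1) = ((gw k).1 - 1 + 2*((4*n + 2 - k)/4), (gw k).2 - 1)

def grC (gx gy : ℤ → ℤ × ℤ) {n : ℤ} : CB n → ℤ × ℤ := fun b => match b with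
  | .inl ⟨k, _⟩ => gx k
  | .inr ⟨l, _⟩ => gy l

def grT (gx gy : ℤ → ℤ × ℤ) {n : ℤ} : CB n × CB n → ℤ × ℤ := fun p =>
  grC gx gy p.1 + grC gx gy p.2

def grD (gw gz : ℤ → ℤ × ℤ) {n : ℤ} : DBs n → ℤ × ℤ := fun b => match b with
  | .inl ⟨k, _⟩ => gw k
  | .inr ⟨l, _⟩ => gz l

/-! ### The submodule `W_n ⊆ C_n ⊗_R C_n` -/

/-- The generators of the `R`-submodule `W_n` of `C_n ⊗_R C_n`. -/
noncomputable def WGens (n : ℤ) : Set (Tc n) :=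
  {ξ | (∃ i : ℤ, i % 2 = 1 ∧ -(2*n - 1) ≤ i ∧ i ≤ 2*n - 1 ∧ ξ = tp (yC n i) (yC n i)) ∨
       (∃ i : ℤ, i % 2 = 1 ∧ -(2*n - 1) ≤ i ∧ i ≤ -3 ∧ ξ = tp (yC n i) (yC n (i + 2))) ∨
       (∃ i : ℤ, i % 2 = 1 ∧ 1 ≤ i ∧ i ≤ 2*n - 3 ∧ ξ = tp (yC n i) (yC n (i + 2))) ∨
       ξ = tp (yC n 1) (yC n (-1)) ∨
       (∃ i : ℤ, i % 2 = 1 ∧ -(2*n - 1) ≤ i ∧ i ≤ -3 ∧ ξ = tp (yC n i) (xC n (i + 1))) ∨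
       (∃ i : ℤ, i % 2 = 1 ∧ 1 ≤ i ∧ i ≤ 2*n - 3 ∧ ξ = tp (yC n i) (xC n (i + 1))) ∨
       (∃ i : ℤ, i % 2 = 0 ∧ -(2*n - 2) ≤ i ∧ i ≤ -2 ∧ ξ = tp (xC n i) (yC n (i + 1))) ∨
       (∃ i : ℤ, i % 2 = 0 ∧ 2 ≤ i ∧ i ≤ 2*n - 2 ∧ ξ = tp (xC n i) (yC n (i + 1))) ∨
       ξ = tp (xC n 0) (yC n (-1)) ∨
       ξ = tp (yC n 1) (xC n 0)}

/-- The `R`-submodule `W_n` of `C_n ⊗_R C_n`. -/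
noncomputable def Wsub (n : ℤ) : Submodule R2 (Tc n) := Submodule.span R2 (WGens n)

/-! ### Bilinearity of `tp` and skew-linearity of `skewExt` -/

section Tensor

variable {β γ : Type}

lemma tp_single_single (a : β) (b : γ) (c d : R2) :
    tp (single a c) (single b d) = single (a, b) (c * d) := by
  simp [tp]

lemma tp_zero_left (g : γ →₀ R2) : tp (0 : β →₀ R2) g = 0 := by
  simp [tp]

lemma tp_zero_right (f : β →₀ R2) : tp f (0 : γ →₀ R2) = 0 := by
  simp [tp]

lemma tp_add_left (f f' : β →₀ R2) (g : γ →₀ R2) : tp (f + f') g = tp f g + tp f' g := by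
  unfold tp
  refine Finsupp.sum_add_index' (fun a => by simp) fun a c c' => ?_
  simp only [add_mul, Finsupp.single_add, Finsupp.sum_add]

lemma tp_add_right (f : β →₀ R2) (g g' : γ →₀ R2) : tp f (g + g') = tp f g + tp f g' := by
  unfold tp
  rw [← Finsupp.sum_add]
  refine Finsupp.sum_congr fun a _ => ?_
  refine Finsupp.sum_add_index' (fun a => by simp) fun a c c' => ?_
  simp only [mul_add, Finsupp.single_add]

lemma tp_smul_left (r : R2) (f : β →₀ R2) (g : γ →₀ R2) : tp (r • f) g = r • tp f g := by
  unfold tp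
  rw [Finsupp.sum_smul_index' (fun a => by simp), Finsupp.smul_sum]
  refine Finsupp.sum_congr fun a _ => ?_
  rw [Finsupp.smul_sum]
  refine Finsupp.sum_congr fun b _ => ?_
  rw [Finsupp.smul_single, smul_eq_mul, smul_eq_mul, mul_assoc]

lemma tp_smul_right (r : R2) (f : β →₀ R2) (g : γ →₀ R2) : tp f (r • g) = r • tp f g := by
  unfold tp
  rw [Finsupp.smul_sum]
  refine Finsupp.sum_congr fun a _ => ?_
  rw [Finsupp.sum_smul_index' (fun a => by simp), Finsupp.smul_sum]
  refine Finsupp.sum_congr fun b _ => ?_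
  rw [Finsupp.smul_single, smul_eq_mul, smul_eq_mul, mul_left_comm]

lemma skewExt_zero (f : β → (γ →₀ R2)) : skewExt f 0 = 0 := by
  simp [skewExt]

lemma skewExt_add (f : β → (γ →₀ R2)) (ξ η : β →₀ R2) :
    skewExt f (ξ + η) = skewExt f ξ + skewExt f η := by
  unfold skewExt
  rw [Finsupp.mapRange_add (fun x y => map_add swUV x y), map_add]

lemma skewExt_single (f : β → (γ →₀ R2)) (b : β) (c : R2) :
    skewExt f (single b c) = swUV c • f b := by
  simp [skewExt]

end Tensor

/-! ### The maps of `C_n` and `C_n ⊗ C_n` on generators -/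

section Generators

variable {n : ℤ}

lemma xC_of_mem {k : ℤ} (h : k % 2 = 0 ∧ -(2*n - 2) ≤ k ∧ k ≤ 2*n - 2) :
    xC n k = single (.inl ⟨k, h⟩) 1 := dif_pos h

lemma yC_of_mem {l : ℤ} (h : l % 2 = 1 ∧ -(2*n - 1) ≤ l ∧ l ≤ 2*n - 1) :
    yC n l = single (.inr ⟨l, h⟩) 1 := dif_pos h

lemma dT_tp_y_y {i j : ℤ} (hi : i % 2 = 1 ∧ -(2*n - 1) ≤ i ∧ i ≤ 2*n - 1)
    (hj : j % 2 = 1 ∧ -(2*n - 1) ≤ j ∧ j ≤ 2*n - 1) :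
    dT n (tp (yC n i) (yC n j)) = 0 := by
  simp [yC_of_mem hi, yC_of_mem hj, tp_single_single, dT, dC, tp_zero_left, tp_zero_right]

lemma dT_tp_y_x {i k : ℤ} (hi : i % 2 = 1 ∧ -(2*n - 1) ≤ i ∧ i ≤ 2*n - 1)
    (hk : k % 2 = 0 ∧ -(2*n - 2) ≤ k ∧ k ≤ 2*n - 2) :
    dT n (tp (yC n i) (xC n k)) =
      VV ^ (((k + 2*n)/2).toNat) • tp (yC n i) (yC n (k - 1)) +
        UU ^ (((2*n - k)/2).toNat) • tp (yC n i) (yC n (k + 1)) := by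
  rw [xC_of_mem hk, yC_of_mem hi, tp_single_single]
  simp [dT, dC, tp_zero_left, tp_add_right, tp_smul_right]

lemma dT_tp_x_y {k i : ℤ} (hk : k % 2 = 0 ∧ -(2*n - 2) ≤ k ∧ k ≤ 2*n - 2)
    (hi : i % 2 = 1 ∧ -(2*n - 1) ≤ i ∧ i ≤ 2*n - 1) :
    dT n (tp (xC n k) (yC n i)) =
      VV ^ (((k + 2*n)/2).toNat) • tp (yC n (k - 1)) (yC n i) +
        UU ^ (((2*n - k)/2).toNat) • tp (yC n (k + 1)) (yC n i) := by
  rw [xC_of_mem hk, yC_of_mem hi, tp_single_single]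
  simp [dT, dC, tp_zero_right, tp_add_left, tp_smul_left]

lemma τexch_tp_y_y {i j : ℤ} (hi : i % 2 = 1 ∧ -(2*n - 1) ≤ i ∧ i ≤ 2*n - 1)
    (hj : j % 2 = 1 ∧ -(2*n - 1) ≤ j ∧ j ≤ 2*n - 1) :
    τexch n (tp (yC n i) (yC n j)) = tp (yC n (-j)) (yC n (-i)) := by
  simp [yC_of_mem hi, yC_of_mem hj, tp_single_single, τexch, skewExt_single, τCb]

lemma τexch_tp_y_x {i k : ℤ} (hi : i % 2 = 1 ∧ -(2*n - 1) ≤ i ∧ i ≤ 2*n - 1)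
    (hk : k % 2 = 0 ∧ -(2*n - 2) ≤ k ∧ k ≤ 2*n - 2) :
    τexch n (tp (yC n i) (xC n k)) = tp (xC n (-k)) (yC n (-i)) := by
  simp [xC_of_mem hk, yC_of_mem hi, tp_single_single, τexch, skewExt_single, τCb]

lemma τexch_tp_x_y {k i : ℤ} (hk : k % 2 = 0 ∧ -(2*n - 2) ≤ k ∧ k ≤ 2*n - 2)
    (hi : i % 2 = 1 ∧ -(2*n - 1) ≤ i ∧ i ≤ 2*n - 1) :
    τexch n (tp (xC n k) (yC n i)) = tp (yC n (-i)) (xC n (-k)) := by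
  simp [xC_of_mem hk, yC_of_mem hi, tp_single_single, τexch, skewExt_single, τCb]

lemma τexch_smul (r : R2) (p : CB n × CB n) (c : R2) :
    τexch n (r • single p c) = swUV r • τexch n (single p c) := by
  rw [Finsupp.smul_single, τexch, skewExt_single, skewExt_single, smul_eq_mul, map_mul,
    mul_smul]

lemma ΨΦT_single_of_isRight {p : CB n × CB n} (h : p.1.isRight ∨ p.2.isRight) :
    ΨΦT n (single p 1) = 0 := by
  obtain ⟨a | a, b | b⟩ := p
  · simp at h
  all_goals simp [ΨΦT, ΨC, ΦC, tp_zero_left, tp_zero_right]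

end Generators

/-! ### The staircase of `W_n` -/

/-- The generator of `W_n` corresponding to the generator `w_k` of `D_n`. -/
noncomputable def wT (n k : ℤ) : Tc n :=
  if k = -1 then tp (xC n 0) (yC n (-1))
  else if k = 1 then tp (yC n 1) (xC n 0)
  else if k % 4 = 3 then tp (yC n ((k - 1)/2)) (xC n ((k - 1)/2 + 1))
  else tp (xC n ((k - 1)/2)) (yC n ((k - 1)/2 + 1))

/-- The generator of `W_n` corresponding to the generator `z_l` of `D_n`. -/
noncomputable def zT (n l : ℤ) : Tc n :=
  if l = 0 then tp (yC n 1) (yC n (-1))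
  else if l % 4 = 2 then tp (yC n (l/2)) (yC n (l/2))
  else tp (yC n (l/2 - 1)) (yC n (l/2 + 1))

lemma wT_neg_one (n : ℤ) : wT n (-1) = tp (xC n 0) (yC n (-1)) := by simp [wT]

lemma wT_one (n : ℤ) : wT n 1 = tp (yC n 1) (xC n 0) := by simp [wT]

lemma wT_y_x (n : ℤ) {i : ℤ} (hi : i % 2 = 1) (h : i ≠ -1) :
    wT n (2*i + 1) = tp (yC n i) (xC n (i + 1)) := by
  rw [wT, if_neg (by omega), if_neg (by omega), if_pos (by omega),
    show (2*i + 1 - 1)/2 = i by omega]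

lemma wT_x_y (n : ℤ) {k : ℤ} (hk : k % 2 = 0) (h : k ≠ 0) :
    wT n (2*k + 1) = tp (xC n k) (yC n (k + 1)) := by
  rw [wT, if_neg (by omega), if_neg (by omega), if_neg (by omega),
    show (2*k + 1 - 1)/2 = k by omega]

lemma zT_zero (n : ℤ) : zT n 0 = tp (yC n 1) (yC n (-1)) := by simp [zT]

lemma zT_diag (n : ℤ) {i : ℤ} (hi : i % 2 = 1) : zT n (2*i) = tp (yC n i) (yC n i) := by
  rw [zT, if_neg (by omega), if_pos (by omega), show 2*i/2 = i by omega]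

lemma zT_off_diag (n : ℤ) {i : ℤ} (hi : i % 2 = 1) (h : i ≠ -1) :
    zT n (2*i + 2) = tp (yC n i) (yC n (i + 2)) := by
  rw [zT, if_neg (by omega), if_neg (by omega), show (2*i + 2)/2 - 1 = i by omega,
    show (2*i + 2)/2 + 1 = i + 2 by omega]

lemma odd_cases {k : ℤ} (hk : k % 2 = 1) :
    k = -1 ∨ k = 1 ∨ (∃ i, i % 2 = 1 ∧ i ≠ -1 ∧ k = 2*i + 1) ∨
      ∃ i, i % 2 = 0 ∧ i ≠ 0 ∧ k = 2*i + 1 := by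
  by_cases h1 : k = -1
  · exact .inl h1
  by_cases h2 : k = 1
  · exact .inr (.inl h2)
  by_cases h3 : k % 4 = 3
  · exact .inr (.inr (.inl ⟨(k - 1)/2, by omega, by omega, by omega⟩))
  · exact .inr (.inr (.inr ⟨(k - 1)/2, by omega, by omega, by omega⟩))

lemma even_cases {l : ℤ} (hl : l % 2 = 0) :
    l = 0 ∨ (∃ i, i % 2 = 1 ∧ l = 2*i) ∨ ∃ i, i % 2 = 1 ∧ i ≠ -1 ∧ l = 2*i + 2 := by
  by_cases h1 : l = 0
  · exact .inl h1
  by_cases h2 : l % 4 = 2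
  · exact .inr (.inl ⟨l/2, by omega, by omega⟩)
  · exact .inr (.inr ⟨l/2 - 1, by omega, by omega, by omega⟩)

lemma dT_wT {n : ℤ} (hn : 1 ≤ n) {k : ℤ}
    (hk : k % 2 = 1 ∧ -(4*n - 3) ≤ k ∧ k ≤ 4*n - 3) :
    dT n (wT n k) = VV ^ (((k + 4*n + 2)/4).toNat) • zT n (k - 1) +
      UU ^ (((4*n + 2 - k)/4).toNat) • zT n (k + 1) := by
  rcases odd_cases hk.1 with rfl | rfl | ⟨i, hi, h, rfl⟩ | ⟨i, hi, h, rfl⟩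
  · rw [wT_neg_one, dT_tp_x_y (by omega) (by omega), show (-1 - 1 : ℤ) = 2 * (-1) by rfl,
      zT_diag n (by rfl), show (-1 + 1 : ℤ) = 0 by rfl, zT_zero,
      show (-1 + 4*n + 2)/4 = (0 + 2*n)/2 by omega,
      show (4*n + 2 - -1)/4 = (2*n - 0)/2 by omega]
    rfl
  · rw [wT_one, dT_tp_y_x (by omega) (by omega), show (1 + 1 : ℤ) = 2 * 1 by rfl,
      zT_diag n (by rfl), show (1 - 1 : ℤ) = 0 by rfl, zT_zero,
      show (1 + 4*n + 2)/4 = (0 + 2*n)/2 by omega,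
      show (4*n + 2 - 1)/4 = (2*n - 0)/2 by omega]
    rfl
  · rw [wT_y_x n hi h, dT_tp_y_x (by omega) (by omega), show 2*i + 1 - 1 = 2*i by ring,
      zT_diag n hi, show 2*i + 1 + 1 = 2*i + 2 by ring, zT_off_diag n hi h,
      show (2*i + 1 + 4*n + 2)/4 = (i + 1 + 2*n)/2 by omega,
      show (4*n + 2 - (2*i + 1))/4 = (2*n - (i + 1))/2 by omega,
      show i + 1 - 1 = i by ring, show i + 1 + 1 = i + 2 by ring]
  · rw [wT_x_y n hi h, dT_tp_x_y (by omega) (by omega),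
      show 2*i + 1 - 1 = 2*(i - 1) + 2 by ring, zT_off_diag n (by omega) (by omega),
      show 2*i + 1 + 1 = 2*(i + 1) by ring, zT_diag n (by omega),
      show (2*i + 1 + 4*n + 2)/4 = (i + 2*n)/2 by omega,
      show (4*n + 2 - (2*i + 1))/4 = (2*n - i)/2 by omega,
      show i - 1 + 2 = i + 1 by ring]

lemma dT_zT {n : ℤ} (hn : 1 ≤ n) {l : ℤ}
    (hl : l % 2 = 0 ∧ -(4*n - 2) ≤ l ∧ l ≤ 4*n - 2) : dT n (zT n l) = 0 := by
  rcases even_cases hl.1 with rfl | ⟨i, hi, rfl⟩ | ⟨i, hi, h, rfl⟩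
  · rw [zT_zero, dT_tp_y_y (by omega) (by omega)]
  · rw [zT_diag n hi, dT_tp_y_y (by omega) (by omega)]
  · rw [zT_off_diag n hi h, dT_tp_y_y (by omega) (by omega)]

lemma τexch_wT {n : ℤ} (hn : 1 ≤ n) {k : ℤ}
    (hk : k % 2 = 1 ∧ -(4*n - 3) ≤ k ∧ k ≤ 4*n - 3) : τexch n (wT n k) = wT n (-k) := by
  rcases odd_cases hk.1 with rfl | rfl | ⟨i, hi, h, rfl⟩ | ⟨i, hi, h, rfl⟩
  · rw [wT_neg_one, τexch_tp_x_y (by omega) (by omega), neg_neg, neg_zero, wT_one]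
  · rw [wT_one, τexch_tp_y_x (by omega) (by omega), neg_zero, wT_neg_one]
  · rw [wT_y_x n hi h, τexch_tp_y_x (by omega) (by omega),
      show -(2*i + 1) = 2*(-(i + 1)) + 1 by ring, wT_x_y n (by omega) (by omega),
      show -(i + 1) + 1 = -i by ring]
  · rw [wT_x_y n hi h, τexch_tp_x_y (by omega) (by omega),
      show -(2*i + 1) = 2*(-(i + 1)) + 1 by ring, wT_y_x n (by omega) (by omega),
      show -(i + 1) + 1 = -i by ring]

lemma τexch_zT {n : ℤ} (hn : 1 ≤ n) {l : ℤ}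
    (hl : l % 2 = 0 ∧ -(4*n - 2) ≤ l ∧ l ≤ 4*n - 2) : τexch n (zT n l) = zT n (-l) := by
  rcases even_cases hl.1 with rfl | ⟨i, hi, rfl⟩ | ⟨i, hi, h, rfl⟩
  · rw [zT_zero, τexch_tp_y_y (by omega) (by omega), neg_zero, zT_zero, neg_neg]
  · rw [zT_diag n hi, τexch_tp_y_y (by omega) (by omega), show -(2*i) = 2*(-i) by ring,
      zT_diag n (by omega)]
  · rw [zT_off_diag n hi h, τexch_tp_y_y (by omega) (by omega),
      show -(2*i + 2) = 2*(-(i + 2)) + 2 by ring, zT_off_diag n (by omega) (by omega),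
      show -(i + 2) + 2 = -i by ring]

/-- The basis element of `C_n ⊗ C_n` to which a basis element of `D_n` is sent. -/
def stairIdx {n : ℤ} (hn : 1 ≤ n) : DBs n → CB n × CB n
  | .inl ⟨k, _⟩ =>
    if k = -1 then (.inl ⟨0, by omega⟩, .inr ⟨-1, by omega⟩)
    else if k = 1 then (.inr ⟨1, by omega⟩, .inl ⟨0, by omega⟩)
    else if _ : k % 4 = 3 then
      (.inr ⟨(k - 1)/2, by omega⟩, .inl ⟨(k - 1)/2 + 1, by omega⟩)
    else (.inl ⟨(k - 1)/2, by omega⟩, .inr ⟨(k - 1)/2 + 1, by omega⟩)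
  | .inr ⟨l, _⟩ =>
    if l = 0 then (.inr ⟨1, by omega⟩, .inr ⟨-1, by omega⟩)
    else if _ : l % 4 = 2 then (.inr ⟨l/2, by omega⟩, .inr ⟨l/2, by omega⟩)
    else (.inr ⟨l/2 - 1, by omega⟩, .inr ⟨l/2 + 1, by omega⟩)

lemma stairIdx_injective {n : ℤ} (hn : 1 ≤ n) : Function.Injective (stairIdx hn) := by
  rintro (⟨a, ha⟩ | ⟨a, ha⟩) (⟨b, hb⟩ | ⟨b, hb⟩) hab <;> simp only [stairIdx] at hab <;>
    split_ifs at hab <;> simp at hab ⊢ <;> omega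

/-- The values of the isomorphism `D_n ≅ W_n` on the basis of `D_n`. -/
noncomputable def stairGen (n : ℤ) : DBs n → Tc n :=
  Sum.elim (fun k => wT n k) (fun l => zT n l)

lemma stairGen_eq_single {n : ℤ} (hn : 1 ≤ n) (b : DBs n) :
    stairGen n b = single (stairIdx hn b) 1 := by
  rcases b with ⟨k, hk⟩ | ⟨l, hl⟩
  · simp only [stairGen, stairIdx, Sum.elim_inl, wT]
    split_ifs <;> rw [xC_of_mem (by omega), yC_of_mem (by omega), tp_single_single, mul_one]
  · simp only [stairGen, stairIdx, Sum.elim_inr, zT]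
    split_ifs
    · rw [yC_of_mem (l := 1) (by omega), yC_of_mem (by omega), tp_single_single, mul_one]
    · rw [yC_of_mem (by omega), tp_single_single, mul_one]
    · rw [yC_of_mem (l := l/2 - 1) (by omega), yC_of_mem (by omega), tp_single_single, mul_one]

lemma isRight_stairIdx {n : ℤ} (hn : 1 ≤ n) (b : DBs n) :
    (stairIdx hn b).1.isRight ∨ (stairIdx hn b).2.isRight := by
  rcases b with ⟨k, hk⟩ | ⟨l, hl⟩ <;> simp only [stairIdx] <;> split_ifs <;> simp

lemma ΨΦT_stairGen {n : ℤ} (hn : 1 ≤ n) (b : DBs n) : ΨΦT n (stairGen n b) = 0 := by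
  rw [stairGen_eq_single hn]
  exact ΨΦT_single_of_isRight (isRight_stairIdx hn b)

/-- The isomorphism from `D_n` onto `W_n`, as a map to `C_n ⊗ C_n`. -/
noncomputable def stairMap (n : ℤ) : Dc n →ₗ[R2] Tc n := linearCombination R2 (stairGen n)

lemma stairMap_single (n : ℤ) (b : DBs n) (c : R2) :
    stairMap n (single b c) = c • stairGen n b := linearCombination_single ..

lemma stairMap_wD {n k : ℤ} (hk : k % 2 = 1 ∧ -(4*n - 3) ≤ k ∧ k ≤ 4*n - 3) :
    stairMap n (wD n k) = wT n k := by
  rw [wD, dif_pos hk, stairMap_single, one_smul]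
  rfl

lemma stairMap_zD {n l : ℤ} (hl : l % 2 = 0 ∧ -(4*n - 2) ≤ l ∧ l ≤ 4*n - 2) :
    stairMap n (zD n l) = zT n l := by
  rw [zD, dif_pos hl, stairMap_single, one_smul]
  rfl

lemma stairMap_injective {n : ℤ} (hn : 1 ≤ n) : Function.Injective (stairMap n) := by
  have h : ∀ ξ, stairMap n ξ = ξ.mapDomain (stairIdx hn) := fun ξ => by
    rw [stairMap, linearCombination_apply, Finsupp.mapDomain]
    exact Finsupp.sum_congr fun b _ => by simp [stairGen_eq_single hn]
  intro ξ η hξη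
  rw [h, h] at hξη
  exact Finsupp.mapDomain_injective (stairIdx_injective hn) hξη

lemma range_stairGen {n : ℤ} (hn : 1 ≤ n) : Set.range (stairGen n) = WGens n := by
  ext ξ
  constructor
  · rintro ⟨⟨k, hk⟩ | ⟨l, hl⟩, rfl⟩
    · change wT n k ∈ WGens n
      rcases odd_cases hk.1 with rfl | rfl | ⟨i, hi, h, rfl⟩ | ⟨i, hi, h, rfl⟩
      · simp [WGens, wT_neg_one]
      · simp [WGens, wT_one]
      · rw [wT_y_x n hi h]
        by_cases h0 : i ≤ -3
        · exact .inr <| .inr <| .inr <| .inr <| .inl ⟨i, hi, by omega, h0, rfl⟩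
        · exact .inr <| .inr <| .inr <| .inr <| .inr <| .inl
            ⟨i, hi, by omega, by omega, rfl⟩
      · rw [wT_x_y n hi h]
        by_cases h0 : i ≤ -2
        · exact .inr <| .inr <| .inr <| .inr <| .inr <| .inr <| .inl
            ⟨i, hi, by omega, h0, rfl⟩
        · exact .inr <| .inr <| .inr <| .inr <| .inr <| .inr <| .inr <| .inl
            ⟨i, hi, by omega, by omega, rfl⟩
    · change zT n l ∈ WGens n
      rcases even_cases hl.1 with rfl | ⟨i, hi, rfl⟩ | ⟨i, hi, h, rfl⟩
      · simp [WGens, zT_zero]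
      · rw [zT_diag n hi]
        exact .inl ⟨i, hi, by omega, by omega, rfl⟩
      · rw [zT_off_diag n hi h]
        by_cases h0 : i ≤ -3
        · exact .inr <| .inl ⟨i, hi, by omega, h0, rfl⟩
        · exact .inr <| .inr <| .inl ⟨i, hi, by omega, by omega, rfl⟩
  · have hw : ∀ k, k % 2 = 1 ∧ -(4*n - 3) ≤ k ∧ k ≤ 4*n - 3 →
        wT n k ∈ Set.range (stairGen n) := fun k hk => ⟨.inl ⟨k, hk⟩, rfl⟩
    have hz : ∀ l, l % 2 = 0 ∧ -(4*n - 2) ≤ l ∧ l ≤ 4*n - 2 →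
        zT n l ∈ Set.range (stairGen n) := fun l hl => ⟨.inr ⟨l, hl⟩, rfl⟩
    rintro (⟨i, hi, h1, h2, rfl⟩ | ⟨i, hi, h1, h2, rfl⟩ | ⟨i, hi, h1, h2, rfl⟩ | rfl |
      ⟨i, hi, h1, h2, rfl⟩ | ⟨i, hi, h1, h2, rfl⟩ | ⟨i, hi, h1, h2, rfl⟩ |
      ⟨i, hi, h1, h2, rfl⟩ | rfl | rfl)
    · exact zT_diag n hi ▸ hz _ (by omega)
    · exact zT_off_diag n hi (by omega) ▸ hz _ (by omega)
    · exact zT_off_diag n hi (by omega) ▸ hz _ (by omega)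
    · exact zT_zero n ▸ hz _ (by omega)
    · exact wT_y_x n hi (by omega) ▸ hw _ (by omega)
    · exact wT_y_x n hi (by omega) ▸ hw _ (by omega)
    · exact wT_x_y n hi (by omega) ▸ hw _ (by omega)
    · exact wT_x_y n hi (by omega) ▸ hw _ (by omega)
    · exact wT_neg_one n ▸ hw _ (by omega)
    · exact wT_one n ▸ hw _ (by omega)

lemma range_stairMap {n : ℤ} (hn : 1 ≤ n) : LinearMap.range (stairMap n) = Wsub n := by
  rw [stairMap, Finsupp.range_linearCombination, range_stairGen hn, Wsub]

lemma stairMap_dD {n : ℤ} (hn : 1 ≤ n) (ξ : Dc n) :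
    stairMap n (dD n ξ) = dT n (stairMap n ξ) := by
  suffices h : stairMap n ∘ₗ dD n = dT n ∘ₗ stairMap n from LinearMap.congr_fun h ξ
  ext1 b
  ext1
  simp only [LinearMap.comp_apply, lsingle_apply, stairMap_single, one_smul]
  rcases b with ⟨k, hk⟩ | ⟨l, hl⟩
  · simp only [dD, linearCombination_single, one_smul, map_add, map_smul]
    rw [stairMap_zD (by omega), stairMap_zD (by omega)]
    exact (dT_wT hn hk).symm
  · simp only [dD, linearCombination_single, smul_zero, map_zero]
    exact (dT_zT hn hl).symm

lemma stairMap_τD {n : ℤ} (hn : 1 ≤ n) (ξ : Dc n) :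
    stairMap n (τD n ξ) = τexch n (stairMap n ξ) := by
  induction ξ using Finsupp.induction_linear with
  | zero => simp [τD, τexch, skewExt_zero]
  | add ξ η hξ hη =>
    rw [map_add, τexch, skewExt_add, ← τexch, ← hξ, ← hη, ← map_add, τD, skewExt_add]
  | single b c =>
    rw [stairMap_single, stairGen_eq_single hn, τexch_smul, ← stairGen_eq_single hn, τD,
      skewExt_single, map_smul]
    congr 1
    rcases b with ⟨k, hk⟩ | ⟨l, hl⟩
    · exact (stairMap_wD (by omega)).trans (τexch_wT hn hk).symm
    · exact (stairMap_zD (by omega)).trans (τexch_zT hn hl).symm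

/-! ### Bigradings -/

/-- Two bigradings of `D_n` agree. -/
lemma IsDGrading.unique {n : ℤ} {gw gz gw' gz' : ℤ → ℤ × ℤ}
    (h : IsDGrading n gw gz) (h' : IsDGrading n gw' gz') (b : DBs n) :
    grD gw gz b = grD gw' gz' b := by
  obtain ⟨hV, hU, hd⟩ := h
  obtain ⟨hV', hU', hd'⟩ := h'
  have key : ∀ k : ℤ, k % 2 = 1 → -(4*n - 3) ≤ k → k ≤ 4*n - 3 →
      ((gz (k - 1)).1 = (gw k).1 - 1 ∧ (gz' (k - 1)).1 = (gw' k).1 - 1) ∧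
      ((gz (k + 1)).2 = (gw k).2 - 1 ∧ (gz' (k + 1)).2 = (gw' k).2 - 1) ∧
      (gz (k - 1)).2 - (gw k).2 = (gz' (k - 1)).2 - (gw' k).2 ∧
      (gz (k + 1)).1 - (gw k).1 = (gz' (k + 1)).1 - (gw' k).1 := by
    intro k h1 h2 h3
    obtain ⟨e1, e2⟩ := hd k h1 h2 h3
    obtain ⟨e3, e4⟩ := hd' k h1 h2 h3
    rw [e1, e2, e3, e4]
    refine ⟨⟨rfl, rfl⟩, ⟨rfl, rfl⟩, ?_, ?_⟩ <;> dsimp only <;> ring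
  have hz2 : ∀ j : ℕ, (j : ℤ) ≤ 4*n - 2 →
      (gz (-(4*n) + 2 + 2*j)).2 = (gz' (-(4*n) + 2 + 2*j)).2 := by
    intro j
    induction j with
    | zero => intro _; simp [hV, hV']
    | succ j ih =>
      intro hj
      push_cast at hj ⊢
      have := ih (by omega)
      have := key (-(4*n) + 2 + 2*j + 1) (by omega) (by omega) (by omega)
      rw [show -(4*n) + 2 + 2*(j : ℤ) + 1 - 1 = -(4*n) + 2 + 2*j by ring,
        show -(4*n) + 2 + 2*(j : ℤ) + 1 + 1 = -(4*n) + 2 + 2*(j + 1) by ring] at this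
      omega
  have hz1 : ∀ j : ℕ, (j : ℤ) ≤ 4*n - 2 →
      (gz (4*n - 2 - 2*j)).1 = (gz' (4*n - 2 - 2*j)).1 := by
    intro j
    induction j with
    | zero => intro _; simp [hU, hU']
    | succ j ih =>
      intro hj
      push_cast at hj ⊢
      have := ih (by omega)
      have := key (4*n - 2 - 2*j - 1) (by omega) (by omega) (by omega)
      rw [show 4*n - 2 - 2*(j : ℤ) - 1 + 1 = 4*n - 2 - 2*j by ring,
        show 4*n - 2 - 2*(j : ℤ) - 1 - 1 = 4*n - 2 - 2*(j + 1) by ring] at this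
      omega
  have hz : ∀ l : ℤ, l % 2 = 0 → -(4*n - 2) ≤ l → l ≤ 4*n - 2 → gz l = gz' l := by
    intro l h1 h2 h3
    have e1 := hz1 ((4*n - 2 - l)/2).toNat (by omega)
    have e2 := hz2 ((l + 4*n - 2)/2).toNat (by omega)
    rw [show 4*n - 2 - 2*(((4*n - 2 - l)/2).toNat : ℤ) = l by omega] at e1
    rw [show -(4*n) + 2 + 2*(((l + 4*n - 2)/2).toNat : ℤ) = l by omega] at e2
    exact Prod.ext e1 e2
  rcases b with ⟨k, h1, h2, h3⟩ | ⟨l, h1, h2, h3⟩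
  · have := key k h1 h2 h3
    rw [hz (k - 1) (by omega) (by omega) (by omega),
      hz (k + 1) (by omega) (by omega) (by omega)] at this
    exact Prod.ext (by simp only [grD]; omega) (by simp only [grD]; omega)
  · exact hz l h1 h2 h3

/-- The bigrading of `D_n` pulled back from `C_n ⊗ C_n` along the isomorphism onto `W_n`. -/
lemma IsCGrading.isDGrading {n : ℤ} {gx gy : ℤ → ℤ × ℤ}
    (h : IsCGrading n gx gy) :
    IsDGrading n
      (fun k => if k % 4 = 3 then gy ((k - 1)/2) + gx ((k - 1)/2 + 1)
        else gx ((k - 1)/2) + gy ((k - 1)/2 + 1))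
      (fun l => if l % 4 = 2 then gy (l/2) + gy (l/2) else gy (l/2 - 1) + gy (l/2 + 1)) := by
  obtain ⟨hV, hU, hd⟩ := h
  refine ⟨?_, ?_, fun k h1 h2 h3 => ?_⟩
  · simp only [show (-(4*n) + 2) % 4 = 2 by omega, if_true,
      show (-(4*n) + 2)/2 = -(2*n) + 1 by omega, Prod.snd_add, hV, add_zero]
  · simp only [show (4*n - 2) % 4 = 2 by omega, if_true,
      show (4*n - 2)/2 = 2*n - 1 by omega, Prod.fst_add, hU, add_zero]
  · obtain ⟨i, rfl⟩ : ∃ i, k = 2*i + 1 := ⟨(k - 1)/2, by omega⟩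
    simp only [show (2*i + 1 - 1)/2 = i by omega]
    by_cases hi : i % 2 = 1
    · obtain ⟨e1, e2⟩ := hd (i + 1) (by omega) (by omega) (by omega)
      rw [if_pos (by omega), if_pos (by omega), if_neg (by omega),
        show (2*i + 1 + 1)/2 - 1 = i by omega, show (2*i + 1 + 1)/2 + 1 = i + 1 + 1 by omega, e2]
      rw [show i + 1 - 1 = i by ring] at e1
      constructor <;> ext <;> simp [e1] <;> omega
    · obtain ⟨e1, e2⟩ := hd i (by omega) (by omega) (by omega)
      rw [if_neg (by omega), if_neg (by omega), if_pos (by omega),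
        show (2*i + 1 + 1)/2 = i + 1 by omega]
      constructor <;> ext <;> simp [e1, e2] <;> omega

lemma grT_stairIdx {n : ℤ} (hn : 1 ≤ n) {gx gy gw gz : ℤ → ℤ × ℤ}
    (hC : IsCGrading n gx gy) (hD : IsDGrading n gw gz) (b : DBs n) :
    grT gx gy (stairIdx hn b) = grD gw gz b := by
  rw [hD.unique (hC.isDGrading) b]
  rcases b with ⟨k, hk⟩ | ⟨l, hl⟩
  · simp only [stairIdx, grD]
    split_ifs <;> first | omega | skip
    all_goals subst_vars; simp [grT, grC, add_comm]
  · simp only [stairIdx, grD]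
    split_ifs <;> first | omega | skip
    all_goals subst_vars; simp [grT, grC, add_comm]

lemma homog_single_one {β : Type} (g : β → ℤ × ℤ) (b : β) : Homog g (g b) (single b 1) := by
  intro a ha m hm
  obtain rfl : a = b := by simpa using (Finsupp.support_single_subset ha)
  obtain rfl : m = 0 := by
    rw [Finsupp.single_eq_same] at hm
    simpa using hm
  simp

/-- (i) `W_n` is a subcomplex of `C_n ⊗_R C_n`; (ii) `Ψ ⊗ Φ`
vanishes identically on `W_n`; (iii) the exchange map `τ_exch` preserves `W_n`; and
(iv) there is a bigraded isomorphism of chain complexes from `D_n` onto `W_n` carrying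
the reflection involution of `D_n` to the restriction to `W_n` of
`(id + Ψ⊗Φ) ∘ τ_exch`. -/
theorem W_subcomplex_isomorphic_to_D (n : ℤ) (hn : 1 ≤ n) :
    -- (i)
    (∀ ξ ∈ Wsub n, dT n ξ ∈ Wsub n) ∧
    -- (ii)
    (∀ ξ ∈ Wsub n, ΨΦT n ξ = 0) ∧
    -- (iii)
    (∀ ξ ∈ Wsub n, τexch n ξ ∈ Wsub n) ∧
    -- (iv)
    (∃ φ : Dc n →ₗ[R2] Tc n,
      Function.Injective φ ∧ LinearMap.range φ = Wsub n ∧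
      (∀ ξ, φ (dD n ξ) = dT n (φ ξ)) ∧
      (∀ ξ, φ (τD n ξ) = τexch n (φ ξ) + ΨΦT n (τexch n (φ ξ))) ∧
      (∀ gx gy gw gz, IsCGrading n gx gy → IsDGrading n gw gz →
        ∀ b : DBs n, Homog (grT gx gy) (grD gw gz b) (φ (single b 1)))) := by
  have hΨΦ : ∀ ξ ∈ Wsub n, ΨΦT n ξ = 0 := by
    suffices h : Wsub n ≤ LinearMap.ker (ΨΦT n) from h
    rw [Wsub, ← range_stairGen hn, Submodule.span_le]
    rintro _ ⟨b, rfl⟩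
    exact ΨΦT_stairGen hn b
  have hτ : ∀ ξ ∈ Wsub n, τexch n ξ ∈ Wsub n := by
    rw [← range_stairMap hn]
    rintro _ ⟨η, rfl⟩
    exact ⟨τD n η, stairMap_τD hn η⟩
  refine ⟨?_, hΨΦ, hτ, stairMap n, stairMap_injective hn, range_stairMap hn, stairMap_dD hn,
    fun ξ => ?_, fun gx gy gw gz hC hD b => ?_⟩
  · rw [← range_stairMap hn]
    rintro _ ⟨η, rfl⟩
    exact ⟨dD n η, stairMap_dD hn η⟩
  · rw [hΨΦ _ (hτ _ (range_stairMap hn ▸ LinearMap.mem_range_self _ ξ)), add_zero,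
      stairMap_τD hn]
  · rw [stairMap_single, one_smul, stairGen_eq_single hn, ← grT_stairIdx hn hC hD b]
    exact homog_single_one _ _
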